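/- Let K be a field, let p be a positive integer, and let R be a p×p reflexive binary matrix. Then for every invertible p×p matrix X over K with X ∈ Sparse(R), one has Struct(X⁻¹) ≤ R^{p-1} (Boolean power). (Lemma A1, part 1.) -/

import Mathlib

/-- Boolean (logical) matrix product. -/
def bmul {m p q : ℕ} (A : Matrix (Fin m) (Fin p) Bool) (B : Matrix (Fin p) (Fin q) Bool) :
    Matrix (Fin m) (Fin q) Bool :=
  fun i k => decide (∃ j, A i j = true ∧ B j k = true)

/-- Identity binary matrix. -/
def bId (p : ℕ) : Matrix (Fin p) (Fin p) Bool := fun i j => decide (i = j)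

/-- Boolean (entrywise OR) sum of binary matrices. -/
def badd {m p : ℕ} (A B : Matrix (Fin m) (Fin p) Bool) : Matrix (Fin m) (Fin p) Bool :=
  fun i j => A i j || B i j

/-- k-fold Boolean power (bpow R 0 = identity). -/
def bpow {p : ℕ} (R : Matrix (Fin p) (Fin p) Bool) : ℕ → Matrix (Fin p) (Fin p) Bool
  | 0 => bId p
  | k + 1 => bmul (bpow R k) R

/-- Entrywise order on binary matrices. -/
def bLE {m p : ℕ} (A B : Matrix (Fin m) (Fin p) Bool) : Prop :=
  ∀ i j, A i j = true → B i j = true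

/-- A square binary matrix is reflexive if all diagonal entries are 1. -/
def BRefl {p : ℕ} (R : Matrix (Fin p) (Fin p) Bool) : Prop := ∀ i, R i i = true

/-- Y ∈ Sparse(T): Y vanishes wherever the pattern T is zero. -/
def Sparse {K : Type*} [Field K] {m p : ℕ} (T : Matrix (Fin m) (Fin p) Bool)
    (Y : Matrix (Fin m) (Fin p) K) : Prop :=
  ∀ i j, T i j = false → Y i j = 0

theorem bpow_le_bpow_succ {p : ℕ} {R : Matrix (Fin p) (Fin p) Bool} (hR : BRefl R) (n : ℕ) :
    bLE (bpow R n) (bpow R (n + 1)) :=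
  fun _ j h => decide_eq_true ⟨j, h, hR j⟩

theorem bpow_mono {p : ℕ} {R : Matrix (Fin p) (Fin p) Bool} (hR : BRefl R) {m n : ℕ}
    (hmn : m ≤ n) : bLE (bpow R m) (bpow R n) := by
  induction n, hmn using Nat.le_induction with
  | base => exact fun _ _ h => h
  | succ n _ ih => exact fun i j h => bpow_le_bpow_succ hR n i j (ih i j h)

theorem Sparse.pow {K : Type*} [Field K] {p : ℕ} {R : Matrix (Fin p) (Fin p) Bool}
    {X : Matrix (Fin p) (Fin p) K} (hX : Sparse R X) (n : ℕ) : Sparse (bpow R n) (X ^ n) := by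
  induction n with
  | zero =>
    intro i j h
    rw [pow_zero, Matrix.one_apply_ne (of_decide_eq_false h)]
  | succ n ih =>
    intro i j h
    rw [pow_succ, Matrix.mul_apply]
    refine Finset.sum_eq_zero fun l _ => ?_
    have hl : ¬(bpow R n i l = true ∧ R l j = true) := fun hl => of_decide_eq_false h ⟨l, hl⟩
    rcases Bool.eq_false_or_eq_true (bpow R n i l) with h₁ | h₁
    · rw [hX l j (Bool.eq_false_iff.2 fun h₂ => hl ⟨h₁, h₂⟩), mul_zero]
    · rw [ih i l h₁, zero_mul]

/-- The Cayley–Hamilton formula for the inverse of a matrix. -/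
theorem Matrix.inv_eq_smul_aeval_divX_charpoly {K n : Type*} [Field K] [Fintype n]
    [DecidableEq n] (X : Matrix n n K) (hX : IsUnit X.det) :
    X⁻¹ = (-(X.charpoly.coeff 0)⁻¹) • Polynomial.aeval X X.charpoly.divX := by
  have hc : X.charpoly.coeff 0 ≠ 0 := fun h =>
    hX.ne_zero (by rw [Matrix.det_eq_sign_charpoly_coeff, h, mul_zero])
  have h := X.aeval_self_charpoly
  rw [← Polynomial.divX_mul_X_add X.charpoly, map_add, map_mul, Polynomial.aeval_X,
    Polynomial.aeval_C, Algebra.algebraMap_eq_smul_one] at h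
  refine Matrix.inv_eq_left_inv ?_
  rw [smul_mul_assoc, eq_neg_of_add_eq_zero_left h, smul_neg, neg_smul, neg_neg, smul_smul,
    inv_mul_cancel₀ hc, one_smul]

/-- Lemma A1, part 1. -/
theorem struct_inv_le_bpow {K : Type*} [Field K] {p : ℕ} (hp : 0 < p)
    (R : Matrix (Fin p) (Fin p) Bool) (hR : BRefl R)
    (X : Matrix (Fin p) (Fin p) K) (hX : IsUnit X.det) (hXs : Sparse R X) :
    ∀ j k, X⁻¹ j k ≠ 0 → bpow R (p - 1) j k = true := by
  intro j k
  contrapose!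
  intro h
  have hdeg : X.charpoly.divX.natDegree = p - 1 := by
    rw [Polynomial.natDegree_divX_eq_natDegree_tsub_one, Matrix.charpoly_natDegree_eq_dim,
      Fintype.card_fin]
  rw [X.inv_eq_smul_aeval_divX_charpoly hX, Polynomial.aeval_eq_sum_range, hdeg,
    Matrix.smul_apply, Matrix.sum_apply, Finset.sum_eq_zero, smul_zero]
  intro i hi
  have hi' : i ≤ p - 1 := Nat.lt_succ_iff.1 (Finset.mem_range.1 hi)
  rw [Matrix.smul_apply, hXs.pow i j k, smul_zero]
  exact Bool.eq_false_iff.2 fun h' => h (bpow_mono hR hi' j k h')
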